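/- Let k ∈ ℤ^n with k ≥ 0 and let K ⊆ [0,k] be a Euclidean cubical complex. Then the image U_k(P_{i_k(K)}) of P_{i_k(K)} under the map λ ↦ λ̄ equals {E_1|…|E_l ∈ R^{pr}_k : for every r ∈ {1,…,l}, the elementary cube [Σ_{s=1}^{r−1} χ_{E_s}, Σ_{s=1}^{r} χ_{E_s}] belongs to K}, where χ_E ∈ {0,1}^n is the characteristic vector of the set E. -/

import Mathlib

section Core

variable {A : Type*} [DecidableEq A] [Fintype A]

/-- A cube of the standard `A`-cube: `none` means `*`, `some true` means `1`,
`some false` means `0`. -/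
abbrev Cube (A : Type*) := A → Option Bool

/-- The cube `c(O, S, rest)` with value `1` on `O`, `*` on `S` and `0` elsewhere. -/
def cubeOn (O S : Finset A) : Cube A := fun a =>
  if a ∈ S then none else if a ∈ O then some true else some false

/-- An `A`-cubical complex: a set of cubes closed under the face maps, i.e. under
replacing any occurrence of `*` by `0` or `1`. -/
def IsComplex (K : Set (Cube A)) : Prop :=
  ∀ c ∈ K, ∀ a : A, c a = none → ∀ ε : Bool, Function.update c a (some ε) ∈ K

/-- Union of the blocks of a list of finsets. -/
def blocksUnion (L : List (Finset A)) : Finset A := L.foldr (· ∪ ·) ∅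

/-- `L` is an ordered partition of `S`: a sequence of nonempty pairwise disjoint
subsets whose union is `S`. -/
def IsOPart (S : Finset A) (L : List (Finset A)) : Prop :=
  (∀ B ∈ L, B.Nonempty) ∧
    List.Pairwise (fun B C : Finset A => Disjoint B C) L ∧ blocksUnion L = S

/-- The set `P_K` of ordered partitions `L = B₁|…|B_l` of `S` such that each cube
`c((O ∪ B₁∪…∪B_{i-1}), B_i, rest)` belongs to `K`.  Here `O` records the part of the
ambient set on which the cubes take the fixed value `1` (used for the restrictions
`K|_B^ε`); for the full complex take `O = ∅`, `S = univ`. -/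
def PK (K : Set (Cube A)) (O S : Finset A) : Set (List (Finset A)) :=
  {L | IsOPart S L ∧ ∀ (i : ℕ) (h : i < L.length),
    cubeOn (O ∪ blocksUnion (L.take i)) (L[i]'h) ∈ K}

/-- `x` refines `y`: the blocks of `y` are obtained by uniting consecutive blocks of `x`. -/
def Refines (x y : List (Finset A)) : Prop :=
  ∃ LL : List (List (Finset A)), (∀ l ∈ LL, l ≠ []) ∧
    x = LL.flatten ∧ y = LL.map blocksUnion

/-- Dimension of an ordered partition: `Σ (#Bᵢ - 1)`. -/
def pdim (L : List (Finset A)) : ℕ := (L.map fun B => B.card - 1).sum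

/-- The facet relation on ordered partitions. -/
def PFacet (x y : List (Finset A)) : Prop :=
  Refines x y ∧ x ≠ y ∧ pdim y = pdim x + 1

/-- A cycle of a discrete vector field on a poset of ordered partitions. -/
def PCycle (V : Set (List (Finset A) × List (Finset A))) (k : ℕ)
    (a : Fin (k + 1) → List (Finset A)) (b : Fin k → List (Finset A)) : Prop :=
  0 < k ∧ a 0 = a (Fin.last k) ∧
    ∀ i : Fin k, (a i.castSucc, b i) ∈ V ∧ (a i.succ, b i) ∉ V ∧ PFacet (a i.succ) (b i)

/-- A discrete vector field on ordered partitions is a gradient field if it has no cycle. -/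
def PGradient (V : Set (List (Finset A) × List (Finset A))) : Prop :=
  ∀ k a b, ¬ PCycle V k a b

/-- Critical cells of a discrete vector field `V` on the set of cells `S`. -/
def CritOn (S : Set (List (Finset A)))
    (V : Set (List (Finset A) × List (Finset A))) : Set (List (Finset A)) :=
  {x | x ∈ S ∧ ∀ p ∈ V, p.1 ≠ x ∧ p.2 ≠ x}

end Core
section Eucl

variable {n : ℕ}

/-- The set `A_k = {(i,j) : 1 ≤ i ≤ n, 1 ≤ j ≤ k_i}`; the element `⟨i, j⟩` with
`j : Fin (k i)` represents the pair `(i, j+1)` of the paper. -/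
abbrev AkT (k : Fin n → ℕ) := Σ i : Fin n, Fin (k i)

/-- The value `j` of an element `(i,j) ∈ A_k`, as an integer. -/
def jval {k : Fin n → ℕ} (p : AkT k) : ℤ := ((p.2 : ℕ) : ℤ) + 1

/-- `[a,b]` is an elementary cube: `a ≤ b ≤ a + 1` coordinatewise. -/
def IsElemCube (a b : Fin n → ℤ) : Prop := a ≤ b ∧ ∀ i, b i ≤ a i + 1

/-- The cube `i_k([a,b])` of the standard `A_k`-cube associated to an elementary
cube `[a,b] ⊆ [0,k]`. -/
def ik (k : Fin n → ℕ) (a b : Fin n → ℤ) : Cube (AkT k) := fun p =>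
  if b p.1 < jval p then some false
  else if jval p ≤ a p.1 then some true
  else none

/-- `⊞^k`: the `A_k`-cubical complex of images under `i_k` of all elementary cubes
contained in `[0,k]`. -/
def boxK (k : Fin n → ℕ) : Set (Cube (AkT k)) :=
  {c | ∃ a b : Fin n → ℤ, IsElemCube a b ∧ 0 ≤ a ∧ (∀ i, b i ≤ (k i : ℤ)) ∧
    c = ik k a b}

/-- The multiset `B̄` over `{1,…,n}` associated to `B ⊆ A_k`, as its multiplicity
function: `i` has multiplicity `#{j : (i,j) ∈ B}`. -/
def mulOf {k : Fin n → ℕ} (B : Finset (AkT k)) : Fin n → ℕ := fun i =>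
  (B.filter fun p => p.1 = i).card

/-- Sum of the multiplicity functions of a list of multisets over `{1,…,n}`. -/
def sumMul (Lb : List (Fin n → ℕ)) : Fin n → ℕ := fun i =>
  (Lb.map fun c => c i).sum

/-- An ordered partition of the multiset `[k]`: a sequence of nonempty multisets
over `{1,…,n}` (given by multiplicity functions) summing to `k`. -/
def IsMPart (k : Fin n → ℕ) (Lb : List (Fin n → ℕ)) : Prop :=
  (∀ c ∈ Lb, c ≠ 0) ∧ sumMul Lb = k

/-- A proper ordered partition of `[k]`: all blocks are sets. -/
def IsProperMPart (k : Fin n → ℕ) (Lb : List (Fin n → ℕ)) : Prop :=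
  IsMPart k Lb ∧ ∀ c ∈ Lb, ∀ i, c i ≤ 1

end Eucl
section Eucl2

variable {n : ℕ}

/-- A Euclidean cubical complex contained in `[0,k]`: a family of elementary cubes
`[a,b] ⊆ [0,k]` (represented by the pairs `(a,b)`) closed under taking elementary
subcubes. -/
def IsEuclComplex (k : Fin n → ℕ) (K : Set ((Fin n → ℤ) × (Fin n → ℤ))) : Prop :=
  (∀ p ∈ K, IsElemCube p.1 p.2 ∧ 0 ≤ p.1 ∧ ∀ i, p.2 i ≤ (k i : ℤ)) ∧
    ∀ p ∈ K, ∀ a b : Fin n → ℤ, IsElemCube a b → p.1 ≤ a → b ≤ p.2 → (a, b) ∈ K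

end Eucl2

/-- The `A_k`-cubical complex `i_k(K)` associated to a Euclidean cubical complex `K`. -/
def ikK {n : ℕ} (k : Fin n → ℕ) (K : Set ((Fin n → ℤ) × (Fin n → ℤ))) :
    Set (Cube (AkT k)) :=
  {c | ∃ p ∈ K, c = ik k p.1 p.2}

section ListLemmas

variable {n : ℕ}

@[simp] lemma sumMul_nil : sumMul ([] : List (Fin n → ℕ)) = 0 := by
  ext i; simp [sumMul]

@[simp] lemma sumMul_cons (c : Fin n → ℕ) (Lb : List (Fin n → ℕ)) :
    sumMul (c :: Lb) = c + sumMul Lb := by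
  ext i; simp [sumMul]

lemma sumMul_append (L₁ L₂ : List (Fin n → ℕ)) :
    sumMul (L₁ ++ L₂) = sumMul L₁ + sumMul L₂ := by
  ext i; simp [sumMul]

lemma sumMul_take_succ (Lb : List (Fin n → ℕ)) {r : ℕ} (h : r < Lb.length) :
    sumMul (Lb.take (r + 1)) = sumMul (Lb.take r) + Lb[r] := by
  rw [List.take_succ_eq_append_getElem h, sumMul_append, sumMul_cons, sumMul_nil, add_zero]

variable {A : Type*} [DecidableEq A]

@[simp] lemma blocksUnion_nil : blocksUnion ([] : List (Finset A)) = ∅ := rfl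

@[simp] lemma blocksUnion_cons (B : Finset A) (L : List (Finset A)) :
    blocksUnion (B :: L) = B ∪ blocksUnion L := rfl

lemma mem_blocksUnion {L : List (Finset A)} {a : A} :
    a ∈ blocksUnion L ↔ ∃ B ∈ L, a ∈ B := by
  induction L with
  | nil => simp
  | cons B L ih => simp [ih]

lemma disjoint_blocksUnion_right {B : Finset A} {L : List (Finset A)} :
    Disjoint B (blocksUnion L) ↔ ∀ C ∈ L, Disjoint B C := by
  simp only [Finset.disjoint_left, mem_blocksUnion]
  grind

end ListLemmas

section Multiplicities

variable {n : ℕ} {k : Fin n → ℕ}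

@[simp] lemma mulOf_empty : mulOf (∅ : Finset (AkT k)) = 0 := by
  ext i; simp [mulOf]

lemma mulOf_union {B C : Finset (AkT k)} (h : Disjoint B C) :
    mulOf (B ∪ C) = mulOf B + mulOf C := by
  ext i
  simp only [mulOf, Pi.add_apply, Finset.filter_union]
  exact Finset.card_union_of_disjoint (Finset.disjoint_filter_filter h)

lemma mulOf_ne_zero_iff {B : Finset (AkT k)} : mulOf B ≠ 0 ↔ B.Nonempty := by
  refine ⟨fun h => ?_, fun ⟨p, hp⟩ h => ?_⟩
  · rw [Finset.nonempty_iff_ne_empty]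
    rintro rfl
    exact h mulOf_empty
  · have h0 : (B.filter fun q => q.1 = p.1).card = 0 := congrFun h p.1
    rw [Finset.card_eq_zero] at h0
    exact Finset.notMem_empty p (h0 ▸ Finset.mem_filter.2 ⟨hp, rfl⟩)

lemma sumMul_map_mulOf {L : List (Finset (AkT k))}
    (h : L.Pairwise fun B C => Disjoint B C) :
    sumMul (L.map fun B => mulOf B) = mulOf (blocksUnion L) := by
  induction L with
  | nil => simp
  | cons B L ih =>
    rw [List.pairwise_cons] at h
    rw [List.map_cons, sumMul_cons, ih h.2, blocksUnion_cons,
      mulOf_union (disjoint_blocksUnion_right.2 h.1)]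

/-- The elements `(i, j)` of `A_k` with `f i < j ≤ g i`. -/
def layer (k f g : Fin n → ℕ) : Finset (AkT k) :=
  Finset.univ.filter fun p => f p.1 ≤ p.2 ∧ (p.2 : ℕ) < g p.1

lemma mem_layer {f g : Fin n → ℕ} {p : AkT k} :
    p ∈ layer k f g ↔ f p.1 ≤ p.2 ∧ (p.2 : ℕ) < g p.1 := by
  simp [layer]

lemma mulOf_layer {f g : Fin n → ℕ} (hg : g ≤ k) : mulOf (layer k f g) = g - f := by
  ext i
  rw [Pi.sub_apply, ← Nat.card_Ico]
  refine Finset.card_bij (fun p _ => (p.2 : ℕ)) ?_ ?_ ?_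
  · rintro ⟨i', j⟩ h
    obtain ⟨hl, rfl⟩ := Finset.mem_filter.1 h
    exact Finset.mem_Ico.2 (mem_layer.1 hl)
  · rintro ⟨i', j⟩ h ⟨i'', j'⟩ h' hj
    obtain ⟨-, rfl⟩ := Finset.mem_filter.1 h
    obtain ⟨-, h'⟩ := Finset.mem_filter.1 h'
    obtain rfl : i'' = i' := h'
    exact congrArg _ (Fin.ext hj)
  · intro j hj
    have hj' := Finset.mem_Ico.1 hj
    exact ⟨⟨i, j, hj'.2.trans_le (hg i)⟩,
      Finset.mem_filter.2 ⟨mem_layer.2 hj', rfl⟩, rfl⟩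

lemma layer_zero_self : layer k 0 k = Finset.univ := by
  ext p; simp [mem_layer]

lemma layer_self (f : Fin n → ℕ) : layer k f f = ∅ := by
  ext p; simp [mem_layer]

lemma layer_union {f g h : Fin n → ℕ} (hfg : f ≤ g) (hgh : g ≤ h) :
    layer k f g ∪ layer k g h = layer k f h := by
  ext p
  have h₁ : f p.1 ≤ g p.1 := hfg p.1
  have h₂ : g p.1 ≤ h p.1 := hgh p.1
  simp only [Finset.mem_union, mem_layer]
  omega

lemma disjoint_layer (f g h : Fin n → ℕ) : Disjoint (layer k f g) (layer k g h) := by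
  simp only [Finset.disjoint_left, mem_layer]
  intro p
  omega

lemma cubeOn_layer {f g : Fin n → ℕ} (hfg : f ≤ g) :
    cubeOn (layer k 0 f) (layer k f g) =
      ik k (fun i => (f i : ℤ)) (fun i => (g i : ℤ)) := by
  ext1 p
  have h : f p.1 ≤ g p.1 := hfg p.1
  simp only [cubeOn, ik, mem_layer, jval, Pi.zero_apply]
  grind

/-- The cube `i_k([a,b])` determines the vertices `a` and `b`. -/
lemma mulOf_eq_of_cubeOn_eq_ik {O S : Finset (AkT k)} {a b : Fin n → ℤ}
    (hab : a ≤ b) (ha : 0 ≤ a) (hb : ∀ i, b i ≤ k i) (hOS : Disjoint O S)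
    (h : cubeOn O S = ik k a b) :
    (∀ i, (mulOf O i : ℤ) = a i) ∧ ∀ i, (mulOf (O ∪ S) i : ℤ) = b i := by
  have key : ∀ p : AkT k, (p ∈ O ↔ jval p ≤ a p.1) ∧ (p ∈ O ∪ S ↔ jval p ≤ b p.1) := by
    intro p
    have hp := congrFun h p
    have h₁ : a p.1 ≤ b p.1 := hab p.1
    have h₂ : p ∈ O → p ∉ S := fun hp => Finset.disjoint_left.1 hOS hp
    rw [Finset.mem_union]
    simp only [cubeOn, ik] at hp
    split_ifs at hp <;> simp_all
    omega
  have layer_eq : ∀ {B : Finset (AkT k)} {c : Fin n → ℤ}, 0 ≤ c → (∀ i, c i ≤ k i) →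
      (∀ p : AkT k, p ∈ B ↔ jval p ≤ c p.1) → ∀ i, (mulOf B i : ℤ) = c i := by
    intro B c hc hck hB i
    have hBc : B = layer k 0 fun i => (c i).toNat := by
      ext p
      have : 0 ≤ c p.1 := hc p.1
      rw [hB, mem_layer, jval]
      simp only [Pi.zero_apply]
      omega
    rw [hBc, mulOf_layer fun i => Int.toNat_le.2 (hck i)]
    simpa using hc i
  exact ⟨layer_eq ha (fun i => (hab i).trans (hb i)) fun p => (key p).1,
    layer_eq (ha.trans hab) hb fun p => (key p).2⟩

/-- The consecutive layers, starting at height `f`, whose thicknesses are the entries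
of the given list. -/
def layers (k : Fin n → ℕ) : (Fin n → ℕ) → List (Fin n → ℕ) → List (Finset (AkT k))
  | _, [] => []
  | f, c :: Lb => layer k f (f + c) :: layers k (f + c) Lb

lemma blocksUnion_layers (f : Fin n → ℕ) (Lb : List (Fin n → ℕ)) :
    blocksUnion (layers k f Lb) = layer k f (f + sumMul Lb) := by
  induction Lb generalizing f with
  | nil => simp [layers, layer_self]
  | cons c Lb ih =>
    rw [layers, blocksUnion_cons, ih, sumMul_cons, ← add_assoc]
    exact layer_union le_self_add le_self_add

lemma length_layers (f : Fin n → ℕ) (Lb : List (Fin n → ℕ)) :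
    (layers k f Lb).length = Lb.length := by
  induction Lb generalizing f with
  | nil => rfl
  | cons c Lb ih => simp [layers, ih]

lemma take_layers (f : Fin n → ℕ) (Lb : List (Fin n → ℕ)) (r : ℕ) :
    (layers k f Lb).take r = layers k f (Lb.take r) := by
  induction Lb generalizing f r with
  | nil => simp [layers]
  | cons c Lb ih => cases r <;> simp [layers, ih]

lemma getElem_layers (f : Fin n → ℕ) (Lb : List (Fin n → ℕ)) (r : ℕ)
    (h : r < (layers k f Lb).length) :
    (layers k f Lb)[r] =
      layer k (f + sumMul (Lb.take r)) (f + sumMul (Lb.take (r + 1))) := by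
  induction Lb generalizing f r with
  | nil => simp [layers] at h
  | cons c Lb ih => cases r <;> simp [layers, ih, add_assoc]

lemma pairwise_disjoint_layers (f : Fin n → ℕ) (Lb : List (Fin n → ℕ)) :
    (layers k f Lb).Pairwise fun B C => Disjoint B C := by
  induction Lb generalizing f with
  | nil => exact List.Pairwise.nil
  | cons c Lb ih =>
    refine List.Pairwise.cons (disjoint_blocksUnion_right.1 ?_) (ih _)
    rw [blocksUnion_layers]
    exact disjoint_layer _ _ _

lemma map_mulOf_layers (f : Fin n → ℕ) (Lb : List (Fin n → ℕ)) (h : f + sumMul Lb ≤ k) :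
    (layers k f Lb).map (fun B => mulOf B) = Lb := by
  induction Lb generalizing f with
  | nil => rfl
  | cons c Lb ih =>
    rw [sumMul_cons, ← add_assoc] at h
    rw [layers, List.map_cons, ih _ h, mulOf_layer (le_self_add.trans h), add_tsub_cancel_left]

end Multiplicities

/-- For a Euclidean cubical complex `K ⊆ [0,k]`, the image of
`P_{i_k(K)}` under `λ ↦ λ̄` is the set of proper ordered partitions `E₁|…|E_l` of
`[k]` such that every elementary cube `[Σ_{s<r} χ_{E_s}, Σ_{s≤r} χ_{E_s}]` is in `K`. -/
theorem stmt_17 (n : ℕ) (k : Fin n → ℕ)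
    (K : Set ((Fin n → ℤ) × (Fin n → ℤ))) (hK : IsEuclComplex k K) :
    {Lb | ∃ L ∈ PK (ikK k K) ∅ Finset.univ, Lb = L.map fun B => mulOf B} =
      {Lb : List (Fin n → ℕ) | IsProperMPart k Lb ∧
        ∀ r : ℕ, r < Lb.length →
          ((fun i => (sumMul (Lb.take r) i : ℤ)),
            fun i => (sumMul (Lb.take (r + 1)) i : ℤ)) ∈ K} := by
  ext Lb
  constructor
  · rintro ⟨L, ⟨⟨hne, hdisj, huniv⟩, hcube⟩, rfl⟩
    have vertices : ∀ r (h : r < L.length), ∃ p ∈ K,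
        (fun i => (sumMul ((L.map fun B => mulOf B).take r) i : ℤ)) = p.1 ∧
        (fun i => (sumMul ((L.map fun B => mulOf B).take (r + 1)) i : ℤ)) = p.2 := by
      intro r h
      obtain ⟨p, hp, hpr⟩ := hcube r h
      obtain ⟨⟨hle, -⟩, h0, hk⟩ := hK.1 p hp
      have hd := hdisj.sublist (List.take_sublist (r + 1) L)
      have hsplit := List.take_succ_eq_append_getElem h
      have hOS : Disjoint (blocksUnion (L.take r)) L[r] := by
        rw [hsplit, List.pairwise_append] at hd
        exact (disjoint_blocksUnion_right.2 fun B hB =>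
          (hd.2.2 B hB _ (List.mem_singleton_self _)).symm).symm
      have hunion : blocksUnion (L.take (r + 1)) = blocksUnion (L.take r) ∪ L[r] := by
        ext q
        simp only [hsplit, Finset.mem_union, mem_blocksUnion, List.mem_append,
          List.mem_singleton]
        grind
      rw [Finset.empty_union] at hpr
      obtain ⟨h₁, h₂⟩ := mulOf_eq_of_cubeOn_eq_ik hle h0 hk hOS hpr
      refine ⟨p, hp, ?_, ?_⟩
      · rw [← List.map_take,
          sumMul_map_mulOf (hdisj.sublist (List.take_sublist r L))]
        exact funext h₁
      · rw [← List.map_take, sumMul_map_mulOf hd, hunion]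
        exact funext h₂
    refine ⟨⟨⟨?_, ?_⟩, ?_⟩, ?_⟩
    · intro c hc
      obtain ⟨B, hB, rfl⟩ := List.mem_map.1 hc
      exact mulOf_ne_zero_iff.2 (hne B hB)
    · rw [sumMul_map_mulOf hdisj, huniv, ← layer_zero_self, mulOf_layer le_rfl, tsub_zero]
    · intro c hc i
      obtain ⟨r, hr, rfl⟩ := List.getElem_of_mem hc
      obtain ⟨p, hp, h₁, h₂⟩ := vertices r (by simpa using hr)
      have h₃ := (hK.1 p hp).1.2 i
      rw [← h₁, ← h₂, sumMul_take_succ _ hr] at h₃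
      simp only [Pi.add_apply] at h₃
      omega
    · intro r hr
      obtain ⟨p, hp, h₁, h₂⟩ := vertices r (by simpa using hr)
      rwa [h₁, h₂]
  · rintro ⟨⟨⟨hne, hsum⟩, -⟩, hcube⟩
    have hmap : (layers k 0 Lb).map (fun B => mulOf B) = Lb :=
      map_mulOf_layers 0 Lb (by rw [zero_add, hsum])
    refine ⟨layers k 0 Lb, ⟨⟨fun B hB => ?_, pairwise_disjoint_layers 0 Lb, ?_⟩, ?_⟩,
      hmap.symm⟩
    · refine mulOf_ne_zero_iff.1 (hne _ ?_)
      rw [← hmap]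
      exact List.mem_map_of_mem hB
    · rw [blocksUnion_layers, zero_add, hsum, layer_zero_self]
    · intro r h
      have hr : r < Lb.length := length_layers (k := k) 0 Lb ▸ h
      refine ⟨_, hcube r hr, ?_⟩
      rw [Finset.empty_union, take_layers, blocksUnion_layers, getElem_layers]
      simp only [zero_add]
      exact cubeOn_layer (sumMul_take_succ Lb hr ▸ le_self_add)
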